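/- arXiv:0811.2935 — 2 statements merged into one kernel-verified Lean document; each statement's English description precedes it below -/
import Mathlib

section
/- Let s be an integer. For all integers l, l' ≥ |s|, −l ≤ m ≤ l, −l' ≤ m' ≤ l', one has ∫₀^π ∫_{−π}^{π} ₛY_{lm}(θ,φ) · conj(ₛY_{l'm'}(θ,φ)) dφ · sin θ dθ = 1 if (l,m) = (l',m') and = 0 otherwise. -/
noncomputable section

/-- Integer binomial coefficient, zero outside `0 ≤ j ≤ n`. -/
def izbinom (n j : ℤ) : ℕ := if 0 ≤ j ∧ j ≤ n then n.toNat.choose j.toNat else 0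

/-- The normalization constant `a_{lm} = √((l+m)!(l−m)!(2l+1)/(4π))`. -/
noncomputable def alm (l m : ℤ) : ℝ :=
  Real.sqrt ((((l + m).toNat.factorial : ℝ) * ((l - m).toNat.factorial : ℝ) * (2 * (l : ℝ) + 1)) /
    (4 * Real.pi))

/-- The spin-`s` spherical harmonic `ₛY_{lm}` in the standard chart, as a function of `(θ, φ)`. -/
noncomputable def sY (s l m : ℤ) (x : ℝ × ℝ) : ℂ :=
  Complex.exp (Complex.I * (m : ℂ) * (x.2 : ℂ)) * (-1 : ℂ) ^ (max (-m) 0) *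
    ((alm l m / Real.sqrt (((l + s).toNat.factorial : ℝ) * ((l - s).toNat.factorial : ℝ)) : ℝ) : ℂ) *
    ((Real.sin (x.1 / 2) : ℂ)) ^ (2 * l) *
    ∑ r ∈ Finset.Icc (0 : ℤ) (l - s),
      (izbinom (l - s) r : ℂ) * (izbinom (l + s) (r + s - m) : ℂ) * (-1 : ℂ) ^ (l - r - s) *
        ((Real.cos (x.1 / 2) / Real.sin (x.1 / 2) : ℝ) : ℂ) ^ (2 * r + s - m)

section

open Finset Polynomial

/-- The alternating binomial sum of a polynomial of degree at most `n` picks out its coefficient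
of degree `n`. -/
theorem sum_neg_one_pow_mul_choose_mul_eval (n : ℕ) (P : ℝ[X]) (hP : P.natDegree ≤ n) :
    ∑ k ∈ range (n + 1), (-1 : ℝ) ^ k * n.choose k * P.eval (k : ℝ)
      = (-1) ^ n * (n.factorial * P.coeff n) := by
  have h1 : (fwdDiff (1 : ℝ))^[n] P.eval 0 = n.factorial * P.coeff n := by
    rcases hP.lt_or_eq with h | h
    · rw [Polynomial.fwdDiff_iter_eq_zero_of_degree_lt h, coeff_eq_zero_of_natDegree_lt h]
      simp
    · subst h
      rw [Polynomial.fwdDiff_iter_degree_eq_factorial]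
      simp [mul_comm]
  rw [← h1, fwdDiff_iter_eq_sum_shift, mul_sum]
  refine sum_congr rfl fun k hk => ?_
  have hk' : k ≤ n := by simpa [Nat.lt_succ_iff] using hk
  obtain ⟨j, rfl⟩ := Nat.exists_eq_add_of_le hk'
  have : (-1 : ℝ) ^ (k + j) * (-1) ^ j = (-1) ^ k := by
    rw [pow_add, mul_assoc, ← mul_pow]; simp
  simp [← this]
  ring

theorem prod_range_intCast_add (x : ℤ) (k : ℕ) (hx : 0 ≤ x + k) :
    ∏ i ∈ range k, ((x : ℝ) + i + 1)
      = if 0 ≤ x then ((x + k).toNat.factorial : ℝ) / x.toNat.factorial else 0 := by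
  split_ifs with h
  · lift x to ℕ using h
    rw [eq_div_iff (by positivity)]
    have : ((x : ℤ) + (k : ℤ)).toNat = x + k := by omega
    rw [this, Int.toNat_natCast, ← Nat.factorial_mul_ascFactorial, Nat.ascFactorial_eq_prod_range]
    push_cast
    rw [mul_comm]
    congr 1
    exact prod_congr rfl fun i _ => by ring
  · refine prod_eq_zero (i := (-x - 1).toNat) (mem_range.2 (by omega)) ?_
    have : (((-x - 1).toNat : ℤ) : ℝ) = ((-x - 1 : ℤ) : ℝ) := by
      rw [Int.toNat_of_nonneg (by omega)]
    rw [Int.cast_natCast] at this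
    rw [this]; push_cast; ring

theorem sum_Icc_intCast {M : Type*} [AddCommMonoid M] (n : ℕ) (f : ℤ → M) :
    ∑ r ∈ Icc (0 : ℤ) n, f r = ∑ k ∈ range (n + 1), f k := by
  symm
  refine sum_nbij' (fun k => (k : ℤ)) Int.toNat ?_ ?_ ?_ ?_ ?_ <;> simp
  intros; omega

theorem izbinom_eq_div {n j : ℤ} (h0 : 0 ≤ j) (h : j ≤ n) :
    (izbinom n j : ℝ)
      = n.toNat.factorial / (j.toNat.factorial * (n - j).toNat.factorial) := by
  rw [izbinom, if_pos ⟨h0, h⟩, Nat.cast_choose ℝ (by omega)]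
  congr 4
  omega

theorem izbinom_eq_zero {n j : ℤ} (h : ¬ (0 ≤ j ∧ j ≤ n)) : izbinom n j = 0 := if_neg h

/-- The coefficient of `cot ^ (2 * r + s - m)` in the definition of `sY`. -/
def sYCoeff (s l m r : ℤ) : ℝ :=
  (izbinom (l - s) r : ℝ) * (izbinom (l + s) (r + s - m) : ℝ) * (-1 : ℝ) ^ (l - r - s)

theorem sYCoeff_ne_zero {s l m r : ℤ} (h : sYCoeff s l m r ≠ 0) :
    (0 ≤ r ∧ r ≤ l - s) ∧ (0 ≤ r + s - m ∧ r + s - m ≤ l + s) := by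
  by_contra hc
  apply h
  rw [not_and_or] at hc
  rcases hc with hc | hc <;> simp [sYCoeff, izbinom_eq_zero hc]

/-- Degree, top coefficient and values of the polynomial `∏ (X + c + i + 1) * ∏ (d - X + i + 1)`. -/
theorem exists_polynomial_prod (c d : ℝ) (a b : ℕ) :
    ∃ P : ℝ[X], P.natDegree = a + b ∧ P.coeff (a + b) = (-1) ^ b ∧
      ∀ x, P.eval x = (∏ i ∈ range a, (x + c + i + 1)) * ∏ i ∈ range b, (d - x + i + 1) := by
  have hd1 : ∀ i : ℕ, (X + C (c + i + 1) : ℝ[X]).natDegree = 1 := fun i => natDegree_X_add_C _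
  have hf : ∀ i : ℕ, (C (-1) * X + C (d + i + 1) : ℝ[X]).natDegree = 1 := fun i =>
    natDegree_linear (by norm_num)
  have hl : ∀ i : ℕ, (C (-1) * X + C (d + i + 1) : ℝ[X]).leadingCoeff = -1 := fun i =>
    leadingCoeff_linear (by norm_num)
  have hn1 : ∀ i : ℕ, (X + C (c + i + 1) : ℝ[X]) ≠ 0 := fun i => X_add_C_ne_zero _
  have hn2 : ∀ i : ℕ, (C (-1) * X + C (d + i + 1) : ℝ[X]) ≠ 0 := fun i h0 => by
    have := hf i
    rw [h0] at this
    simp at this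
  have hdeg : ((∏ i ∈ range a, (X + C (c + i + 1))) *
      ∏ i ∈ range b, (C (-1) * X + C (d + i + 1)) : ℝ[X]).natDegree = a + b := by
    rw [natDegree_mul (prod_ne_zero_iff.2 fun i _ => hn1 i) (prod_ne_zero_iff.2 fun i _ => hn2 i),
      natDegree_prod _ _ fun i _ => hn1 i, natDegree_prod _ _ fun i _ => hn2 i]
    simp only [hd1, hf]
    simp
  refine ⟨_, hdeg, ?_, fun x => ?_⟩
  · rw [← hdeg, coeff_natDegree, leadingCoeff_mul, leadingCoeff_prod, leadingCoeff_prod]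
    simp only [hl, leadingCoeff_X_add_C]
    simp
  · rw [eval_mul, eval_prod, eval_prod]
    congr 1 <;> refine prod_congr rfl fun i _ => ?_ <;> simp <;> ring

theorem sum_sYCoeff_mul_factorial {s l l' m k : ℤ} (hl : |s| ≤ l) (hll : l' ≤ l)
    (hm : -l ≤ m)
    (hk : (0 ≤ k ∧ k ≤ l' - s) ∧ (0 ≤ k + s - m ∧ k + s - m ≤ l' + s)) :
    ∑ r ∈ Icc (0 : ℤ) (l - s), sYCoeff s l m r *
        ((r + k + s - m).toNat.factorial * (l + l' - (r + k + s - m)).toNat.factorial)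
      = if l' = l then
          ((l - s).toNat.factorial : ℝ) * (l + s).toNat.factorial * (-1) ^ (l - k - s) else 0 := by
  obtain ⟨hs1, hs2⟩ := abs_le.1 hl
  obtain ⟨⟨k1, k2⟩, k3, k4⟩ := hk
  obtain ⟨n, hn⟩ := Int.eq_ofNat_of_zero_le (show 0 ≤ l + m by omega)
  obtain ⟨a, rfl⟩ := Int.eq_ofNat_of_zero_le k1
  obtain ⟨b, hb⟩ := Int.eq_ofNat_of_zero_le (show 0 ≤ l' + m - a by omega)
  obtain ⟨P, hP1, hP2, hP3⟩ := exists_polynomial_prod ((s - m : ℤ) : ℝ) ((l - s : ℤ) : ℝ) a b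
  have key := sum_neg_one_pow_mul_choose_mul_eval n P (by omega)
  have hterm : ∀ r ∈ range (n + 1), sYCoeff s l m r *
        ((r + a + s - m).toNat.factorial * (l + l' - (r + a + s - m)).toNat.factorial)
      = ((l - s).toNat.factorial : ℝ) * (l + s).toNat.factorial * (-1) ^ (l - s)
          / n.factorial * ((-1 : ℝ) ^ r * n.choose r * P.eval (r : ℝ)) := by
    intro r hr
    have hr' : r ≤ n := by simpa [Nat.lt_succ_iff] using hr
    have e1 : ∏ i ∈ range a, ((r : ℝ) + ((s - m : ℤ) : ℝ) + i + 1)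
        = ∏ i ∈ range a, (((r + s - m : ℤ) : ℝ) + i + 1) :=
       prod_congr rfl fun i _ => by push_cast; ring
    have e2 : ∏ i ∈ range b, (((l - s : ℤ) : ℝ) - r + i + 1)
        = ∏ i ∈ range b, (((l - s - r : ℤ) : ℝ) + i + 1) :=
       prod_congr rfl fun i _ => by push_cast; ring
    rw [hP3, e1, e2, prod_range_intCast_add _ a (by omega), prod_range_intCast_add _ b (by omega)]
    by_cases c1 : 0 ≤ (r : ℤ) + s - m
    · by_cases c2 : 0 ≤ l - s - r
      · rw [if_pos c1, if_pos c2, sYCoeff, izbinom_eq_div (by omega) (by omega),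
          izbinom_eq_div (by omega) (by omega), Nat.cast_choose ℝ hr']
        have f1 : (l + s - (r + s - m)).toNat = n - r := by omega
        have f2 : ((r : ℤ) + s - m + a).toNat = (r + a + s - m).toNat := by congr 1; ring
        have f3 : (l - s - r + b).toNat = (l + l' - (r + a + s - m)).toNat := by
          congr 1; omega
        have f4 : (-1 : ℝ) ^ (l - r - s) = (-1) ^ (l - s) * (-1) ^ r := by
          rw [show l - r - s = (l - s) - r by ring, zpow_sub₀ (by norm_num), zpow_natCast,
            div_eq_mul_inv, ← inv_pow]
          norm_num
        rw [f1, f2, f3, f4, Int.toNat_natCast]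
        field_simp
      · rw [if_neg c2, sYCoeff, izbinom_eq_zero (n := l - s) (by omega)]
        simp
    · rw [if_neg c1, sYCoeff, izbinom_eq_zero (n := l + s) (by omega)]
      simp
  have hrange : ∑ r ∈ Icc (0 : ℤ) (l - s), sYCoeff s l m r *
        ((r + a + s - m).toNat.factorial * (l + l' - (r + a + s - m)).toNat.factorial)
      = ∑ r ∈ Icc (0 : ℤ) n, sYCoeff s l m r *
        ((r + a + s - m).toNat.factorial * (l + l' - (r + a + s - m)).toNat.factorial) := by
    refine sum_congr_of_eq_on_inter ?_ ?_ fun _ _ _ => rfl <;> intro r h1 h2 <;>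
      rw [mul_eq_zero] <;> left <;> by_contra hne <;>
      have := sYCoeff_ne_zero hne <;> simp at h1 h2 <;> omega
  rw [hrange, sum_Icc_intCast]
  rw [sum_congr rfl hterm, ← mul_sum, key]
  split_ifs with h
  · have hab : a + b = n := by omega
    have h4 : (-1 : ℝ) ^ (l - a - s) = (-1) ^ (l - s) * (-1) ^ a := by
      rw [show l - a - s = (l - s) - a by ring, zpow_sub₀ (by norm_num), zpow_natCast,
        div_eq_mul_inv, ← inv_pow]
      norm_num
    have h5 : (-1 : ℝ) ^ n * (-1) ^ b = (-1) ^ a := by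
      rw [← hab, pow_add, mul_assoc, ← mul_pow]; simp
    rw [← hab] at key ⊢
    rw [hP2, h4, hab, ← h5]
    field_simp
  · rw [coeff_eq_zero_of_natDegree_lt (by omega)]
    simp

theorem sum_izbinom_mul_izbinom {s l m : ℤ} (hl : |s| ≤ l) (hm : -l ≤ m) (hm2 : m ≤ l) :
    ∑ k ∈ Icc (0 : ℤ) (l - s), (izbinom (l - s) k : ℝ) * izbinom (l + s) (k + s - m)
      = (2 * l).toNat.factorial / ((l + m).toNat.factorial * (l - m).toNat.factorial) := by
  obtain ⟨hs1, hs2⟩ := abs_le.1 hl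
  obtain ⟨a, ha⟩ := Int.eq_ofNat_of_zero_le (show 0 ≤ l + s by omega)
  obtain ⟨b, hb⟩ := Int.eq_ofNat_of_zero_le (show 0 ≤ l - s by omega)
  obtain ⟨n, hn⟩ := Int.eq_ofNat_of_zero_le (show 0 ≤ l + m by omega)
  have hrange : ∑ k ∈ Icc (0 : ℤ) (l - s), (izbinom (l - s) k : ℝ) * izbinom (l + s) (k + s - m)
      = ∑ k ∈ Icc (0 : ℤ) n, (izbinom (l - s) k : ℝ) * izbinom (l + s) (k + s - m) := by
    refine sum_congr_of_eq_on_inter ?_ ?_ fun _ _ _ => rfl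
    all_goals
      intro r h1 h2
      simp only [mem_Icc, not_and, not_le] at h1 h2
    · rw [izbinom_eq_zero (n := l + s) (by omega)]; simp
    · rw [izbinom_eq_zero (n := l - s) (by omega)]; simp
  have h1 := Nat.add_choose_eq b a n
  rw [Nat.sum_antidiagonal_eq_sum_range_succ_mk] at h1
  rw [hrange, sum_Icc_intCast]
  have h2 : ∀ k ∈ range (n + 1), (izbinom (l - s) k : ℝ) * izbinom (l + s) (k + s - m)
      = ((b.choose k * a.choose (n - k) : ℕ) : ℝ) := by
    intro k hk
    have hk' : k ≤ n := by simpa [Nat.lt_succ_iff] using hk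
    rw [Nat.cast_mul]
    congr 2
    · rw [izbinom]
      split_ifs with h
      · congr 1
        omega
      · rw [Nat.choose_eq_zero_of_lt (by omega)]
    · rw [izbinom]
      split_ifs with h
      · rw [← Nat.choose_symm (by omega)]
        congr 1 <;> omega
      · by_cases h3 : (k : ℤ) + s - m < 0
        · rw [Nat.choose_eq_zero_of_lt (by omega)]
        · omega
  rw [sum_congr rfl h2, ← Nat.cast_sum, ← h1, Nat.cast_choose ℝ (by omega)]
  congr 4 <;> omega

theorem sum_sum_sYCoeff_of_le {s l l' m : ℤ} (hl : |s| ≤ l) (hll : l' ≤ l)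
    (hm : -l ≤ m) (hm2 : m ≤ l) :
    ∑ k ∈ Icc (0 : ℤ) (l' - s), ∑ r ∈ Icc (0 : ℤ) (l - s), sYCoeff s l m r * sYCoeff s l' m k *
        ((r + k + s - m).toNat.factorial * (l + l' - (r + k + s - m)).toNat.factorial)
      = if l = l' then ((l - s).toNat.factorial : ℝ) * (l + s).toNat.factorial *
          ((2 * l).toNat.factorial / ((l + m).toNat.factorial * (l - m).toNat.factorial))
        else 0 := by
  have h1 : ∀ k ∈ Icc (0 : ℤ) (l' - s),
      ∑ r ∈ Icc (0 : ℤ) (l - s), sYCoeff s l m r * sYCoeff s l' m k *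
        ((r + k + s - m).toNat.factorial * (l + l' - (r + k + s - m)).toNat.factorial)
      = sYCoeff s l' m k * if l' = l then
          ((l - s).toNat.factorial : ℝ) * (l + s).toNat.factorial * (-1) ^ (l - k - s)
          else 0 := by
    intro k hk
    by_cases h0 : sYCoeff s l' m k = 0
    · simp [h0]
    · rw [← sum_sYCoeff_mul_factorial hl hll hm (sYCoeff_ne_zero h0), mul_sum]
      exact sum_congr rfl fun r _ => by ring
  rw [sum_congr rfl h1]
  by_cases h : l = l'
  · subst h
    simp only [if_true]
    rw [← sum_izbinom_mul_izbinom hl hm hm2, mul_sum]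
    refine sum_congr rfl fun k _ => ?_
    have : (-1 : ℝ) ^ (l - k - s) * (-1) ^ (l - k - s) = 1 := by
      rw [← mul_zpow]; simp
    rw [sYCoeff]
    linear_combination ((izbinom (l - s) k : ℝ) * (izbinom (l + s) (k + s - m) : ℝ) *
      ((l - s).toNat.factorial : ℝ) * (l + s).toNat.factorial) * this
  · simp [h, Ne.symm h]

theorem integral_pow_mul_one_sub_pow (a b : ℕ) :
    ∫ t in (0 : ℝ)..1, t ^ a * (1 - t) ^ b
      = (a.factorial : ℝ) * b.factorial / (a + b + 1).factorial := by
  have h := Complex.Gamma_mul_Gamma_eq_betaIntegral (s := (a : ℂ) + 1) (t := (b : ℂ) + 1)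
    (by simp; positivity) (by simp; positivity)
  rw [show (a : ℂ) + 1 + (b + 1) = ((a + b + 1 : ℕ) : ℂ) + 1 by push_cast; ring,
    Complex.Gamma_nat_eq_factorial, Complex.Gamma_nat_eq_factorial,
    Complex.Gamma_nat_eq_factorial, Complex.betaIntegral] at h
  have h2 : (∫ x in (0 : ℝ)..1, (x : ℂ) ^ ((a : ℂ) + 1 - 1) * (1 - (x : ℂ)) ^ ((b : ℂ) + 1 - 1))
      = ((∫ t in (0 : ℝ)..1, t ^ a * (1 - t) ^ b : ℝ) : ℂ) := by
    rw [← intervalIntegral.integral_ofReal]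
    refine intervalIntegral.integral_congr fun x _ => ?_
    simp
  rw [h2] at h
  rw [eq_div_iff (by positivity), mul_comm]
  exact_mod_cast h.symm

theorem integral_cos_sq_pow_mul_sin_sq_pow_mul_sin (a b : ℕ) :
    ∫ θ in (0 : ℝ)..Real.pi,
        (Real.cos (θ / 2) ^ 2) ^ a * (Real.sin (θ / 2) ^ 2) ^ b * Real.sin θ
      = 2 * ((a.factorial : ℝ) * b.factorial / (a + b + 1).factorial) := by
  have hd : ∀ x ∈ Set.uIcc (0 : ℝ) Real.pi,
      HasDerivAt (fun θ : ℝ => Real.cos (θ / 2) ^ 2) (-Real.sin x / 2) x := by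
    intro x _
    have h1 : HasDerivAt (fun θ : ℝ => Real.cos (θ / 2)) (-Real.sin (x / 2) * (1 / 2)) x :=
      ((hasDerivAt_id x).div_const 2).cos
    refine (h1.pow 2).congr_deriv ?_
    have : Real.sin x = 2 * Real.sin (x / 2) * Real.cos (x / 2) := by
      rw [← Real.sin_two_mul]; congr 1; ring
    rw [this]
    simp
    ring
  have h := intervalIntegral.integral_comp_mul_deriv hd (g := fun t : ℝ => t ^ a * (1 - t) ^ b)
    (by fun_prop) (by fun_prop)
  have h0 : Real.cos (0 / 2) ^ 2 = 1 := by simp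
  have hpi : Real.cos (Real.pi / 2) ^ 2 = 0 := by simp
  simp only [h0, hpi] at h
  rw [intervalIntegral.integral_symm 0 1, integral_pow_mul_one_sub_pow] at h
  have h3 : ∀ x : ℝ, (Real.cos (x / 2) ^ 2) ^ a * (Real.sin (x / 2) ^ 2) ^ b * Real.sin x
      = (-2) * (((fun t : ℝ => t ^ a * (1 - t) ^ b) ∘ fun θ : ℝ => Real.cos (θ / 2) ^ 2) x *
          (-Real.sin x / 2)) := by
    intro x
    simp only [Function.comp]
    rw [Real.sin_sq]
    ring
  simp only [h3]
  rw [intervalIntegral.integral_const_mul, h]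
  ring

/-- The `θ`-dependence of `sY`, without its normalization constant. -/
def sYPolar (s l m : ℤ) (θ : ℝ) : ℝ :=
  Real.sin (θ / 2) ^ (2 * l) * ∑ r ∈ Icc (0 : ℤ) (l - s),
    sYCoeff s l m r * (Real.cos (θ / 2) / Real.sin (θ / 2)) ^ (2 * r + s - m)

/-- The normalization constant of `sY`. -/
def sYNorm (s l m : ℤ) : ℝ :=
  alm l m / Real.sqrt (((l + s).toNat.factorial : ℝ) * ((l - s).toNat.factorial : ℝ))

theorem sY_eq (s l m : ℤ) (θ φ : ℝ) :
    sY s l m (θ, φ) = Complex.exp (Complex.I * m * φ) *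
      (((-1 : ℝ) ^ (max (-m) 0) * (sYNorm s l m * sYPolar s l m θ) : ℝ) : ℂ) := by
  simp only [sY, sYPolar, sYNorm, sYCoeff]
  push_cast
  ring

theorem sYPolar_mul_sYPolar {s l l' m : ℤ} {θ : ℝ} (hθ : θ ∈ Set.Ioo 0 Real.pi) :
    sYPolar s l m θ * sYPolar s l' m θ
      = ∑ k ∈ Icc (0 : ℤ) (l' - s), ∑ r ∈ Icc (0 : ℤ) (l - s),
        sYCoeff s l m r * sYCoeff s l' m k *
          ((Real.cos (θ / 2) ^ 2) ^ (r + k + s - m).toNat *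
            (Real.sin (θ / 2) ^ 2) ^ (l + l' - (r + k + s - m)).toNat) := by
  have hs : Real.sin (θ / 2) ≠ 0 :=
    (Real.sin_pos_of_pos_of_lt_pi (by linarith [hθ.1]) (by linarith [hθ.1, hθ.2])).ne'
  have hc : Real.cos (θ / 2) ≠ 0 :=
    (Real.cos_pos_of_mem_Ioo ⟨by linarith [hθ.1, Real.pi_pos], by linarith [hθ.2]⟩).ne'
  rw [sYPolar, sYPolar, mul_mul_mul_comm, sum_mul_sum, sum_comm, mul_sum]
  refine sum_congr rfl fun k _ => ?_
  rw [mul_sum]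
  refine sum_congr rfl fun r _ => ?_
  by_cases h1 : sYCoeff s l m r = 0
  · simp [h1]
  by_cases h2 : sYCoeff s l' m k = 0
  · simp [h2]
  obtain ⟨⟨a1, a2⟩, a3, a4⟩ := sYCoeff_ne_zero h1
  obtain ⟨⟨b1, b2⟩, b3, b4⟩ := sYCoeff_ne_zero h2
  have e1 : (Real.cos (θ / 2) ^ 2) ^ (r + k + s - m).toNat
      = Real.cos (θ / 2) ^ (2 * (r + k + s - m)) := by
    rw [← zpow_natCast, Int.toNat_of_nonneg (by omega), zpow_mul]
    norm_cast
  have e2 : (Real.sin (θ / 2) ^ 2) ^ (l + l' - (r + k + s - m)).toNat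
      = Real.sin (θ / 2) ^ (2 * (l + l' - (r + k + s - m))) := by
    rw [← zpow_natCast, Int.toNat_of_nonneg (by omega), zpow_mul]
    norm_cast
  have e3 : Real.cos (θ / 2) ^ (2 * (r + k + s - m))
      = Real.cos (θ / 2) ^ (2 * r + s - m) * Real.cos (θ / 2) ^ (2 * k + s - m) := by
    rw [← zpow_add₀ hc]; congr 1; ring
  have e4 : Real.sin (θ / 2) ^ (2 * (l + l' - (r + k + s - m)))
      = Real.sin (θ / 2) ^ (2 * l) * Real.sin (θ / 2) ^ (2 * l') /
        (Real.sin (θ / 2) ^ (2 * r + s - m) * Real.sin (θ / 2) ^ (2 * k + s - m)) := by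
    rw [← zpow_add₀ hs, ← zpow_add₀ hs, ← zpow_sub₀ hs]; congr 1; ring
  rw [e1, e2, e3, e4, div_zpow, div_zpow]
  ring

theorem integral_sYPolar_of_le {s l l' m : ℤ} (hl : |s| ≤ l) (hl' : |s| ≤ l') (hll : l' ≤ l)
    (hm : -l ≤ m) (hm2 : m ≤ l) :
    ∫ θ in (0 : ℝ)..Real.pi, sYPolar s l m θ * sYPolar s l' m θ * Real.sin θ
      = if l = l' then 2 * (((l - s).toNat.factorial : ℝ) * (l + s).toNat.factorial /
          ((l + m).toNat.factorial * (l - m).toNat.factorial * (2 * l + 1))) else 0 := by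
  have hl0 : 0 ≤ l := (abs_nonneg s).trans hl
  have hl0' : 0 ≤ l' := (abs_nonneg s).trans hl'
  have h1 : ∫ θ in (0 : ℝ)..Real.pi, sYPolar s l m θ * sYPolar s l' m θ * Real.sin θ
      = ∫ θ in (0 : ℝ)..Real.pi, ∑ k ∈ Icc (0 : ℤ) (l' - s), ∑ r ∈ Icc (0 : ℤ) (l - s),
        sYCoeff s l m r * sYCoeff s l' m k *
          ((Real.cos (θ / 2) ^ 2) ^ (r + k + s - m).toNat *
            (Real.sin (θ / 2) ^ 2) ^ (l + l' - (r + k + s - m)).toNat * Real.sin θ) := by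
    refine intervalIntegral.integral_congr_Ioo_of_le Real.pi_pos.le fun θ hθ => ?_
    simp only [sYPolar_mul_sYPolar hθ, sum_mul]
    exact sum_congr rfl fun k _ => sum_congr rfl fun r _ => by ring
  have h2 : ∀ k ∈ Icc (0 : ℤ) (l' - s), ∀ r ∈ Icc (0 : ℤ) (l - s),
      ∫ θ in (0 : ℝ)..Real.pi, sYCoeff s l m r * sYCoeff s l' m k *
          ((Real.cos (θ / 2) ^ 2) ^ (r + k + s - m).toNat *
            (Real.sin (θ / 2) ^ 2) ^ (l + l' - (r + k + s - m)).toNat * Real.sin θ)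
        = 2 / (l + l' + 1).toNat.factorial * (sYCoeff s l m r * sYCoeff s l' m k *
          ((r + k + s - m).toNat.factorial * (l + l' - (r + k + s - m)).toNat.factorial)) := by
    intro k _ r _
    by_cases h1 : sYCoeff s l m r = 0
    · simp [h1]
    by_cases h2 : sYCoeff s l' m k = 0
    · simp [h2]
    have a := sYCoeff_ne_zero h1
    have b := sYCoeff_ne_zero h2
    rw [intervalIntegral.integral_const_mul, integral_cos_sq_pow_mul_sin_sq_pow_mul_sin,
      show (r + k + s - m).toNat + (l + l' - (r + k + s - m)).toNat + 1 = (l + l' + 1).toNat by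
        omega]
    ring
  have hint : ∀ k r : ℤ, IntervalIntegrable (fun θ : ℝ => sYCoeff s l m r * sYCoeff s l' m k *
          ((Real.cos (θ / 2) ^ 2) ^ (r + k + s - m).toNat *
            (Real.sin (θ / 2) ^ 2) ^ (l + l' - (r + k + s - m)).toNat * Real.sin θ))
        MeasureTheory.volume 0 Real.pi := fun k r =>
    Continuous.intervalIntegrable (by fun_prop) _ _
  rw [h1, intervalIntegral.integral_finsetSum fun k _ =>
    Continuous.intervalIntegrable (by fun_prop) _ _]
  simp_rw [intervalIntegral.integral_finsetSum fun r _ => hint _ r]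
  rw [sum_congr rfl fun k hk => sum_congr rfl (h2 k hk)]
  simp_rw [← mul_sum]
  rw [sum_sum_sYCoeff_of_le hl hll hm hm2]
  split_ifs with h
  · subst h
    rw [show (l + l + 1).toNat = (2 * l).toNat + 1 by omega, Nat.factorial_succ]
    have : (((2 * l).toNat : ℕ) : ℝ) = 2 * l := by
      have : (((2 * l).toNat : ℤ) : ℝ) = ((2 * l : ℤ) : ℝ) := by
        rw [Int.toNat_of_nonneg (by omega)]
      rwa [Int.cast_natCast, Int.cast_mul, Int.cast_ofNat] at this
    push_cast
    rw [this]
    have : (0 : ℝ) ≤ l := by exact_mod_cast hl0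
    field_simp
  · simp

theorem integral_sYPolar {s l l' m : ℤ} (hl : |s| ≤ l) (hl' : |s| ≤ l')
    (hm : -l ≤ m) (hm2 : m ≤ l) (hm' : -l' ≤ m) (hm2' : m ≤ l') :
    ∫ θ in (0 : ℝ)..Real.pi, sYPolar s l m θ * sYPolar s l' m θ * Real.sin θ
      = if l = l' then 2 * (((l - s).toNat.factorial : ℝ) * (l + s).toNat.factorial /
          ((l + m).toNat.factorial * (l - m).toNat.factorial * (2 * l + 1))) else 0 := by
  rcases le_total l' l with h | h
  · exact integral_sYPolar_of_le hl hl' h hm hm2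
  · have := integral_sYPolar_of_le hl' hl h hm' hm2'
    simp only [mul_comm (sYPolar s l m _)]
    rw [this]
    by_cases hll : l = l'
    · subst hll; rfl
    · rw [if_neg hll, if_neg (Ne.symm hll)]

theorem sYNorm_sq {s l m : ℤ} (hl : 0 ≤ l) :
    2 * Real.pi * (sYNorm s l m ^ 2 * (2 * (((l - s).toNat.factorial : ℝ) *
      (l + s).toNat.factorial /
        ((l + m).toNat.factorial * (l - m).toNat.factorial * (2 * l + 1))))) = 1 := by
  have : (0 : ℝ) ≤ l := by exact_mod_cast hl
  have hpi := Real.pi_pos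
  rw [sYNorm, alm, div_pow, Real.sq_sqrt (by positivity), Real.sq_sqrt (by positivity)]
  field_simp
  norm_num

theorem integral_exp_I_mul_int (n : ℤ) :
    ∫ φ in (-Real.pi)..Real.pi, Complex.exp (Complex.I * n * φ)
      = if n = 0 then 2 * (Real.pi : ℂ) else 0 := by
  split_ifs with h
  · subst h
    simp
    ring
  · rw [integral_exp_mul_complex (mul_ne_zero Complex.I_ne_zero (by exact_mod_cast h)),
      div_eq_zero_iff, sub_eq_zero, Complex.exp_eq_exp_iff_exists_int]
    refine Or.inl ⟨n, ?_⟩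
    push_cast
    ring

end

/-- **Orthonormality of the spin-`s` spherical harmonics** (Statement 3). -/
theorem sY_orthonormal (s l l' m m' : ℤ) (hl : |s| ≤ l) (hl' : |s| ≤ l')
    (hm : -l ≤ m) (hm2 : m ≤ l) (hm' : -l' ≤ m') (hm'2 : m' ≤ l') :
    (∫ θ in (0:ℝ)..Real.pi,
        (∫ φ in (-Real.pi)..Real.pi,
          sY s l m (θ, φ) * (starRingEnd ℂ) (sY s l' m' (θ, φ))) * (Real.sin θ : ℂ))
      = if l = l' ∧ m = m' then 1 else 0 := by
  have hφ : ∀ θ : ℝ, (∫ φ in (-Real.pi)..Real.pi,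
        sY s l m (θ, φ) * (starRingEnd ℂ) (sY s l' m' (θ, φ)))
      = (if m - m' = 0 then 2 * (Real.pi : ℂ) else 0) *
        (((-1 : ℝ) ^ (max (-m) 0) * (sYNorm s l m * sYPolar s l m θ) *
          ((-1 : ℝ) ^ (max (-m') 0) * (sYNorm s l' m' * sYPolar s l' m' θ)) : ℝ) : ℂ) := by
    intro θ
    rw [← integral_exp_I_mul_int, ← intervalIntegral.integral_mul_const]
    refine intervalIntegral.integral_congr fun φ _ => ?_
    have he : Complex.exp (Complex.I * (m - m' : ℤ) * φ)
        = Complex.exp (Complex.I * m * φ) *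
          (starRingEnd ℂ) (Complex.exp (Complex.I * m' * φ)) := by
      rw [← Complex.exp_conj, ← Complex.exp_add]
      congr 1
      simp
      ring
    simp only [sY_eq]
    rw [he, map_mul, Complex.conj_ofReal]
    simp only [Complex.ofReal_mul]
    ring
  simp only [hφ]
  by_cases hmm : m = m'
  · subst hmm
    have hsign : (-1 : ℝ) ^ (max (-m) 0) * (-1 : ℝ) ^ (max (-m) 0) = 1 := by
      rw [← mul_zpow]; simp
    have hθ : ∀ θ : ℝ, (if m - m = 0 then 2 * (Real.pi : ℂ) else 0) *
        (((-1 : ℝ) ^ (max (-m) 0) * (sYNorm s l m * sYPolar s l m θ) *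
          ((-1 : ℝ) ^ (max (-m) 0) * (sYNorm s l' m * sYPolar s l' m θ)) : ℝ) : ℂ) *
          (Real.sin θ : ℂ)
        = ((2 * Real.pi * (sYNorm s l m * sYNorm s l' m) *
          (sYPolar s l m θ * sYPolar s l' m θ * Real.sin θ) : ℝ) : ℂ) := by
      intro θ
      rw [if_pos (sub_self m), show (2 * (Real.pi : ℂ)) = ((2 * Real.pi : ℝ) : ℂ) by push_cast; rfl,
        ← Complex.ofReal_mul, ← Complex.ofReal_mul]
      congr 1
      linear_combination (2 * Real.pi * (sYNorm s l m * sYNorm s l' m) *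
          (sYPolar s l m θ * sYPolar s l' m θ * Real.sin θ)) * hsign
    simp only [hθ]
    rw [intervalIntegral.integral_ofReal, intervalIntegral.integral_const_mul,
      integral_sYPolar hl hl' hm hm2 hm' hm'2]
    by_cases hll : l = l'
    · subst hll
      have := sYNorm_sq (s := s) (m := m) ((abs_nonneg s).trans hl)
      simp only [if_true, and_self]
      rw [← Complex.ofReal_one]
      congr 1
      refine Eq.trans ?_ this
      ring
    · simp [hll]
  · simp [sub_eq_zero, hmm]
end
end

section
/- Let s be an integer. For every compact set F ⊂ (0,π)×ℝ and all nonnegative integers i, j there exist constants C > 0 and M ≥ 0 such that for all integers l ≥ |s|, all −l ≤ m ≤ l, and all (θ,φ) ∈ F, |∂^i/∂θ^i ∂^j/∂φ^j ₛY_{lm}(θ,φ)| ≤ C (l+1)^M. -/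
noncomputable section

/-- Partial derivative in the first variable. -/
noncomputable def pdθ (h : ℝ × ℝ → ℂ) : ℝ × ℝ → ℂ := fun x => deriv (fun t => h (t, x.2)) x.1

/-- Partial derivative in the second variable. -/
noncomputable def pdφ (h : ℝ × ℝ → ℂ) : ℝ × ℝ → ℂ := fun x => deriv (fun t => h (x.1, t)) x.2

open Polynomial in
theorem coeff_linear_pow (a b : ℝ) (n k : ℕ) :
    ((C a * X + C b) ^ n).coeff k = a ^ k * b ^ (n - k) * (n.choose k : ℝ) := by
  have h : (C a * X + C b) ^ n = ((X + C b) ^ n).comp (C a * X) := by simp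
  rw [h, comp_C_mul_X_coeff, coeff_X_add_C_pow]
  ring

/-- A curve of polynomials is differentiable coefficientwise. -/
def HasCoeffDerivAt (P : ℝ → Polynomial ℝ) (P' : Polynomial ℝ) (t : ℝ) : Prop :=
  ∀ k, HasDerivAt (fun x => (P x).coeff k) (P'.coeff k) t

theorem HasCoeffDerivAt.mul {P Q : ℝ → Polynomial ℝ} {P' Q' : Polynomial ℝ} {t : ℝ}
    (hP : HasCoeffDerivAt P P' t) (hQ : HasCoeffDerivAt Q Q' t) :
    HasCoeffDerivAt (fun x => P x * Q x) (P' * Q t + P t * Q') t := by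
  intro k
  simp only [Polynomial.coeff_mul, Polynomial.coeff_add, ← Finset.sum_add_distrib]
  exact HasDerivAt.fun_sum fun p _ => (hP p.1).mul (hQ p.2)

theorem HasCoeffDerivAt.pow {P : ℝ → Polynomial ℝ} {P' : Polynomial ℝ} {t : ℝ}
    (hP : HasCoeffDerivAt P P' t) (n : ℕ) :
    HasCoeffDerivAt (fun x => P x ^ n) (n * P t ^ (n - 1) * P') t := by
  induction n with
  | zero => intro k; simpa using hasDerivAt_const t ((1 : Polynomial ℝ).coeff k)
  | succ n ih =>
    have h := ih.mul hP
    simp only [← pow_succ] at h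
    have e : ((n + 1 : ℕ) : Polynomial ℝ) * P t ^ (n + 1 - 1) * P' =
        n * P t ^ (n - 1) * P' * P t + P t ^ n * P' := by
      cases n with
      | zero => simp
      | succ n => push_cast [Nat.add_sub_cancel]; ring
    rw [e]
    exact h

open Polynomial in
/-- The image of `X ^ a` (homogenized to degree `a + b`) under rotation by the angle `t / 2`. -/
def rotPoly (a b : ℕ) (t : ℝ) : Polynomial ℝ :=
  (C (Real.cos (t / 2)) * X + C (-Real.sin (t / 2))) ^ a *
    (C (Real.sin (t / 2)) * X + C (Real.cos (t / 2))) ^ b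

open Polynomial in
theorem hasCoeffDerivAt_rotPoly (a b : ℕ) (t : ℝ) :
    HasCoeffDerivAt (rotPoly a b)
      (C (1 / 2) * (((a + b : ℕ) : Polynomial ℝ) * X * rotPoly a b t
        - (1 + X ^ 2) * derivative (rotPoly a b t))) t := by
  have hhalf : HasDerivAt (fun x : ℝ => x / 2) (1 / 2) t := (hasDerivAt_id t).div_const 2
  have hc := (Real.hasDerivAt_cos (t / 2)).comp t hhalf
  have hs := (Real.hasDerivAt_sin (t / 2)).comp t hhalf
  have lin : ∀ {f g : ℝ → ℝ} {f' g' : ℝ}, HasDerivAt f f' t → HasDerivAt g g' t →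
      HasCoeffDerivAt (fun x => C (f x) * X + C (g x)) (C f' * X + C g') t := by
    intro f g f' g' hf hg k
    simp only [coeff_add, coeff_C_mul, coeff_C]
    refine (hf.mul_const _).add ?_
    split_ifs
    · exact hg
    · exact hasDerivAt_const _ _
  have h := ((lin hc hs.neg).pow a).mul ((lin hs hc).pow b)
  intro k
  refine (h k).congr_deriv (congrArg (fun p => coeff p k) ?_)
  have hA : ∀ (u : Polynomial ℝ) (n : ℕ), (n : Polynomial ℝ) * u ^ n = n * u ^ (n - 1) * u := by
    intro u n
    cases n with
    | zero => simp
    | succ n => simp [pow_succ, mul_assoc]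
  simp only [rotPoly, map_neg, map_mul, Pi.neg_apply, Function.comp, derivative_mul,
    derivative_pow, derivative_add, derivative_C, derivative_X]
  set c := C (Real.cos (t / 2))
  set s := C (Real.sin (t / 2))
  push_cast
  have h1 := hA (c * X + -s) a
  have h2 := hA (s * X + c) b
  simp only [map_natCast]
  linear_combination -(C (1 / 2)) * X * (s * X + c) ^ b * h1 -
    (C (1 / 2)) * X * (c * X + -s) ^ a * h2

theorem hasDerivAt_rotPoly_coeff (a b k : ℕ) (t : ℝ) :
    HasDerivAt (fun x => (rotPoly a b x).coeff k)
      (1 / 2 * ((if k = 0 then 0 else ((a + b : ℝ) - k + 1) * (rotPoly a b t).coeff (k - 1))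
        - (k + 1) * (rotPoly a b t).coeff (k + 1))) t := by
  refine (hasCoeffDerivAt_rotPoly a b t k).congr_deriv ?_
  rw [Polynomial.coeff_C_mul]
  congr 1
  rw [Polynomial.coeff_sub, add_mul (1 : Polynomial ℝ), Polynomial.coeff_add, mul_assoc,
    Polynomial.coeff_natCast_mul, one_mul, Polynomial.coeff_derivative]
  rcases k with _ | _ | k
  · simp [Polynomial.mul_coeff_zero]
  · simp [pow_two, mul_assoc, Polynomial.coeff_X_mul, Polynomial.mul_coeff_zero]
    ring
  · simp [pow_two, mul_assoc, Polynomial.coeff_X_mul, Polynomial.coeff_derivative]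
    ring

theorem rotPoly_coeff_eq_zero (a b k : ℕ) (t : ℝ) (hk : a + b < k) :
    (rotPoly a b t).coeff k = 0 := by
  apply Polynomial.coeff_eq_zero_of_natDegree_lt
  refine lt_of_le_of_lt ?_ hk
  unfold rotPoly
  compute_degree

/-- The rescaled coefficients, orthonormal coordinates for the Bombieri norm. -/
def rotCoeff (a b k : ℕ) (t : ℝ) : ℝ :=
  √((k.factorial : ℝ) * ((a + b - k).factorial : ℝ)) * (rotPoly a b t).coeff k

/-- The matrix entries of the generator of rotations. -/
def ladder (n k : ℕ) : ℝ := √((k : ℝ) * ((n : ℝ) + 1 - k)) / 2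

theorem hasDerivAt_rotCoeff (a b k : ℕ) (t : ℝ) :
    HasDerivAt (rotCoeff a b k)
      (ladder (a + b) k * rotCoeff a b (k - 1) t
        - ladder (a + b) (k + 1) * rotCoeff a b (k + 1) t) t := by
  by_cases hk : a + b < k
  · have h0 : rotCoeff a b k = fun _ => 0 := by
      funext x; simp [rotCoeff, rotPoly_coeff_eq_zero a b k x hk]
    have h1 : ladder (a + b) k * rotCoeff a b (k - 1) t = 0 := by
      by_cases h : k = a + b + 1
      · subst h; simp [ladder]
      · simp [rotCoeff, rotPoly_coeff_eq_zero a b (k - 1) t (by omega)]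
    have h2 : rotCoeff a b (k + 1) t = 0 := by
      simp [rotCoeff, rotPoly_coeff_eq_zero a b (k + 1) t (by omega)]
    rw [h0, h1, h2]
    simpa using hasDerivAt_const t (0 : ℝ)
  push Not at hk
  refine ((hasDerivAt_rotPoly_coeff a b k t).const_mul
    (√((k.factorial : ℝ) * ((a + b - k).factorial : ℝ)))).congr_deriv ?_
  have key : ∀ j : ℕ, j + 1 ≤ a + b →
      √(((j + 1 : ℕ) : ℝ) * (((a + b : ℕ) : ℝ) + 1 - ((j + 1 : ℕ) : ℝ))) *
        √((j.factorial : ℝ) * ((a + b - j).factorial : ℝ)) =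
      (((a + b : ℕ) : ℝ) - j) * √(((j + 1).factorial : ℝ) * ((a + b - (j + 1)).factorial : ℝ)) ∧
      √(((j + 1 : ℕ) : ℝ) * (((a + b : ℕ) : ℝ) + 1 - ((j + 1 : ℕ) : ℝ))) *
        √(((j + 1).factorial : ℝ) * ((a + b - (j + 1)).factorial : ℝ)) =
      (j + 1) * √((j.factorial : ℝ) * ((a + b - j).factorial : ℝ)) := by
    intro j hj
    obtain ⟨d, hd⟩ := Nat.exists_eq_add_of_le hj
    have e1 : a + b - j = d + 1 := by omega
    have e2 : a + b - (j + 1) = d := by omega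
    rw [e1, e2, hd]
    push_cast [Nat.factorial_succ]
    have e3 : (j : ℝ) + 1 + d + 1 - (j + 1) = d + 1 := by ring
    have e4 : (j : ℝ) + 1 + d - j = d + 1 := by ring
    rw [e3, e4]
    constructor
    · rw [← Real.sqrt_mul (by positivity), ← Real.sqrt_sq (show (0 : ℝ) ≤ d + 1 by positivity),
        ← Real.sqrt_mul (by positivity), Real.sqrt_sq (by positivity)]
      congr 1; ring
    · rw [← Real.sqrt_mul (by positivity), ← Real.sqrt_sq (show (0 : ℝ) ≤ j + 1 by positivity),
        ← Real.sqrt_mul (by positivity), Real.sqrt_sq (by positivity)]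
      congr 1; ring
  have hlow : ladder (a + b) k * rotCoeff a b (k - 1) t =
      √((k.factorial : ℝ) * ((a + b - k).factorial : ℝ)) * (1 / 2 *
        (if k = 0 then 0 else ((a + b : ℝ) - k + 1) * (rotPoly a b t).coeff (k - 1))) := by
    rcases k with _ | j
    · simp [ladder]
    · have := (key j hk).1
      simp only [Nat.add_sub_cancel, ladder, rotCoeff, Nat.succ_ne_zero, if_false]
      push_cast at this ⊢
      linear_combination (rotPoly a b t).coeff j / 2 * this
  have hup : ladder (a + b) (k + 1) * rotCoeff a b (k + 1) t =
      √((k.factorial : ℝ) * ((a + b - k).factorial : ℝ)) * (1 / 2 *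
        ((k + 1) * (rotPoly a b t).coeff (k + 1))) := by
    by_cases h : k + 1 ≤ a + b
    · have := (key k h).2
      simp only [ladder, rotCoeff]
      linear_combination (rotPoly a b t).coeff (k + 1) / 2 * this
    · simp [rotCoeff, rotPoly_coeff_eq_zero a b (k + 1) t (by omega)]
  rw [hlow, hup]
  ring

theorem sum_rotCoeff_sq (a b : ℕ) (t : ℝ) :
    ∑ k ∈ Finset.range (a + b + 1), rotCoeff a b k t ^ 2 = a.factorial * b.factorial := by
  have hd : ∀ x, HasDerivAt (fun y => ∑ k ∈ Finset.range (a + b + 1), rotCoeff a b k y ^ 2) 0 x := by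
    intro x
    have h := HasDerivAt.fun_sum (u := Finset.range (a + b + 1))
      fun k _ => (hasDerivAt_rotCoeff a b k x).pow 2
    refine h.congr_deriv ?_
    have hz : rotCoeff a b (a + b + 1) x = 0 := by
      simp [rotCoeff, rotPoly_coeff_eq_zero a b (a + b + 1) x (by omega)]
    let f : ℕ → ℝ := fun k => 2 * ladder (a + b) k * rotCoeff a b (k - 1) x * rotCoeff a b k x
    have hf : ∀ k, ((2 : ℕ) : ℝ) * rotCoeff a b k x ^ (2 - 1) *
        (ladder (a + b) k * rotCoeff a b (k - 1) x
        - ladder (a + b) (k + 1) * rotCoeff a b (k + 1) x) = f k - f (k + 1) := by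
      intro k
      simp only [f, Nat.add_sub_cancel]
      push_cast
      ring
    rw [Finset.sum_congr rfl fun k _ => hf k, Finset.sum_range_sub']
    simp [f, hz, ladder]
  have hc := is_const_of_deriv_eq_zero (fun x => (hd x).differentiableAt)
    (fun x => (hd x).deriv) t 0
  have h0 : ∀ k, (rotPoly a b 0).coeff k = if k = a then 1 else 0 := by
    intro k
    simp [rotPoly, Polynomial.coeff_X_pow]
  rw [hc, Finset.sum_eq_single a]
  · simp only [rotCoeff, h0, if_true, mul_one, Nat.add_sub_cancel_left]
    exact Real.sq_sqrt (by positivity)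
  · intro k _ hk
    simp [rotCoeff, h0, hk]
  · intro h
    simp at h

theorem abs_rotCoeff_le (a b k : ℕ) (t : ℝ) :
    |rotCoeff a b k t| ≤ √((a.factorial : ℝ) * b.factorial) := by
  by_cases hk : a + b < k
  · rw [rotCoeff, rotPoly_coeff_eq_zero a b k t hk, mul_zero, abs_zero]
    positivity
  · rw [← sum_rotCoeff_sq a b t]
    apply Real.abs_le_sqrt
    exact Finset.single_le_sum (f := fun k => rotCoeff a b k t ^ 2) (fun i _ => sq_nonneg _)
      (Finset.mem_range.2 (by omega))

theorem abs_ladder_le (n k : ℕ) : |ladder n k| ≤ ((n : ℝ) + 1) / 2 := by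
  unfold ladder
  rw [abs_of_nonneg (by positivity)]
  gcongr
  apply Real.sqrt_le_iff.2
  exact ⟨by positivity, by nlinarith [sq_nonneg ((n : ℝ) + 1), sq_nonneg ((n : ℝ) + 1 - 2 * k)]⟩

/-- Derivative bounds for solutions of a bounded tridiagonal linear system. -/
theorem norm_iteratedDeriv_le_of_ladder {α β : ℕ → ℝ} {K : ℝ} (hα : ∀ k, |α k| ≤ K)
    (hβ : ∀ k, |β k| ≤ K) (i : ℕ) :
    ∀ (f : ℕ → ℝ → ℂ) (B : ℝ),
      (∀ k t, HasDerivAt (f k) (α k * f (k - 1) t - β k * f (k + 1) t) t) →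
      (∀ k t, ‖f k t‖ ≤ B) → ∀ k t, ‖iteratedDeriv i (f k) t‖ ≤ (2 * K) ^ i * B := by
  induction i with
  | zero => intro f B _ hB k t; simpa using hB k t
  | succ i ih =>
    intro f B hf hB k t
    have hK : 0 ≤ K := (abs_nonneg _).trans (hα 0)
    have hderiv : deriv (f k) = fun t => α k * f (k - 1) t - β k * f (k + 1) t :=
      funext fun t => (hf k t).deriv
    rw [iteratedDeriv_succ', hderiv]
    refine (ih (fun k t => α k * f (k - 1) t - β k * f (k + 1) t) (2 * K * B)
      (fun k t => ((hf (k - 1) t).const_mul _).sub ((hf (k + 1) t).const_mul _))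
      (fun k t => ?_) k t).trans_eq (by ring)
    refine (norm_sub_le _ _).trans ?_
    rw [norm_mul, norm_mul, Complex.norm_real, Complex.norm_real, Real.norm_eq_abs,
      Real.norm_eq_abs]
    have h1 := mul_le_mul (hα k) (hB (k - 1) t) (norm_nonneg _) hK
    have h2 := mul_le_mul (hβ k) (hB (k + 1) t) (norm_nonneg _) hK
    linarith

theorem pdθ_iterate (h : ℝ × ℝ → ℂ) (i : ℕ) (x : ℝ × ℝ) :
    pdθ^[i] h x = iteratedDeriv i (fun t => h (t, x.2)) x.1 := by
  induction i generalizing x with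
  | zero => simp
  | succ i ih =>
    rw [Function.iterate_succ_apply', iteratedDeriv_succ]
    unfold pdθ at *
    simp only [ih]

theorem pdφ_iterate_sY (s l m : ℤ) (j : ℕ) :
    pdφ^[j] (sY s l m) = fun x => (Complex.I * m) ^ j * sY s l m x := by
  induction j with
  | zero => simp
  | succ j ih =>
    rw [Function.iterate_succ_apply', ih]
    funext x
    have h1 : HasDerivAt (fun t : ℝ => Complex.exp (Complex.I * m * (t : ℂ)))
        (Complex.exp (Complex.I * m * (x.2 : ℂ)) * (Complex.I * m)) x.2 := by
      have h := ((hasDerivAt_id (x.2 : ℂ)).const_mul (Complex.I * (m : ℂ))).cexp.comp_ofReal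
      simpa using h
    have h2 : ∀ t : ℝ, sY s l m (x.1, t) =
        Complex.exp (Complex.I * m * (t : ℂ)) * sY s l m (x.1, 0) := by
      intro t
      simp only [sY, Complex.ofReal_zero, mul_zero, Complex.exp_zero, one_mul, mul_assoc]
    have h3 := (h1.mul_const (sY s l m (x.1, 0))).const_mul ((Complex.I * (m : ℂ)) ^ j)
    have h4 : (fun t : ℝ => (Complex.I * (m : ℂ)) ^ j * sY s l m (x.1, t)) = fun t : ℝ =>
        (Complex.I * (m : ℂ)) ^ j *
          (Complex.exp (Complex.I * m * (t : ℂ)) * sY s l m (x.1, 0)) :=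
      funext fun t => by rw [h2 t]
    have h5 : sY s l m x = _ := h2 x.2
    simp only [pdφ]
    rw [h4, h3.deriv, h5]
    ring

theorem wigner_sum_eq {s l m : ℤ} (hs : |s| ≤ l) (hm : -l ≤ m) {t : ℝ}
    (ht : Real.sin (t / 2) ≠ 0) :
    ((Real.sin (t / 2) : ℂ)) ^ (2 * l) *
    ∑ r ∈ Finset.Icc (0 : ℤ) (l - s),
      (izbinom (l - s) r : ℂ) * (izbinom (l + s) (r + s - m) : ℂ) * (-1 : ℂ) ^ (l - r - s) *
        ((Real.cos (t / 2) / Real.sin (t / 2) : ℝ) : ℂ) ^ (2 * r + s - m) =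
    (((rotPoly (l - s).toNat (l + s).toNat t).coeff (l + m).toNat : ℝ) : ℂ) := by
  obtain ⟨hs1, hs2⟩ := abs_le.1 hs
  obtain ⟨a, ha⟩ := Int.eq_ofNat_of_zero_le (show 0 ≤ l - s by omega)
  obtain ⟨b, hb⟩ := Int.eq_ofNat_of_zero_le (show 0 ≤ l + s by omega)
  obtain ⟨n, hn⟩ := Int.eq_ofNat_of_zero_le (show 0 ≤ l + m by omega)
  rw [hn, hb, ha]
  simp only [Int.toNat_natCast]
  set c := Real.cos (t / 2) with hc
  set σ := Real.sin (t / 2) with hσ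
  have hσ' : (σ : ℂ) ≠ 0 := by exact_mod_cast ht
  let g : ℕ → ℝ := fun r => if r ≤ n then
    (c ^ r * (-σ) ^ (a - r) * (a.choose r : ℝ)) *
      (σ ^ (n - r) * c ^ (b - (n - r)) * (b.choose (n - r) : ℝ)) else 0
  have hcoeff : (rotPoly a b t).coeff n = ∑ r ∈ Finset.range (a + 1), g r := by
    unfold rotPoly
    rw [Polynomial.coeff_mul, Finset.Nat.sum_antidiagonal_eq_sum_range_succ_mk]
    simp only [coeff_linear_pow, ← hc, ← hσ]
    trans ∑ r ∈ Finset.range (a + n + 1), g r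
    · rw [← Finset.sum_subset (Finset.range_subset_range.2 (show n + 1 ≤ a + n + 1 by omega))]
      · refine Finset.sum_congr rfl fun r hr => ?_
        rw [Finset.mem_range] at hr
        simp only [g, if_pos (show r ≤ n by omega)]
      · intro r _ hr
        rw [Finset.mem_range] at hr
        simp only [g, if_neg (show ¬ r ≤ n by omega)]
    · symm
      refine Finset.sum_subset (Finset.range_subset_range.2 (by omega)) fun r _ hr => ?_
      rw [Finset.mem_range] at hr
      simp [g, Nat.choose_eq_zero_of_lt (show a < r by omega)]
  rw [hcoeff]
  have hIcc : Finset.Icc (0 : ℤ) (a : ℤ) = (Finset.range (a + 1)).map Nat.castEmbedding := by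
    ext z
    simp only [Finset.mem_Icc, Finset.mem_map, Finset.mem_range, Nat.castEmbedding_apply]
    constructor
    · intro h
      exact ⟨z.toNat, by omega, by omega⟩
    · rintro ⟨y, hy, rfl⟩
      omega
  rw [hIcc, Finset.sum_map, Finset.mul_sum, Complex.ofReal_sum]
  refine Finset.sum_congr rfl fun r hr => ?_
  rw [Finset.mem_range] at hr
  simp only [Nat.castEmbedding_apply]
  by_cases hrn : r ≤ n
  · by_cases hk : n - r ≤ b
    · have e1 : (r : ℤ) + s - m = ((b - (n - r) : ℕ) : ℤ) := by omega
      have e2 : l - (r : ℤ) - s = ((a - r : ℕ) : ℤ) := by omega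
      have e3 : 2 * (r : ℤ) + s - m = ((r + (b - (n - r)) : ℕ) : ℤ) := by omega
      have e4 : 2 * l = (((a - r) + (n - r) + (r + (b - (n - r))) : ℕ) : ℤ) := by omega
      rw [e1, e2, e3, e4]
      simp only [zpow_natCast, izbinom, Int.toNat_natCast, g, if_pos hrn]
      rw [if_pos (by omega), if_pos (by omega), Nat.choose_symm hk, Complex.ofReal_div, div_pow,
        neg_pow σ]
      push_cast
      rw [pow_add (σ : ℂ) (a - r + (n - r))]
      field_simp
      ring
    · have h0 : izbinom (b : ℤ) (r + s - m) = 0 := by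
        unfold izbinom
        rw [if_neg (by omega)]
      simp [g, h0, Nat.choose_eq_zero_of_lt (show b < n - r by omega)]
  · have h0 : izbinom (b : ℤ) (r + s - m) = 0 := by
      unfold izbinom
      rw [if_neg (by omega)]
    simp [g, h0, hrn]

/-- The factor of `∂_φ^j ₛY_{lm}` independent of `θ`. -/
def sYPrefactor (s l m : ℤ) (j : ℕ) (φ : ℝ) : ℂ :=
  (Complex.I * m) ^ j * (Complex.exp (Complex.I * (m : ℂ) * (φ : ℂ)) * (-1 : ℂ) ^ (max (-m) 0)) *
    ((√((2 * (l : ℝ) + 1) / (4 * Real.pi)) /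
      √(((l + s).toNat.factorial : ℝ) * ((l - s).toNat.factorial : ℝ)) : ℝ) : ℂ)

theorem pdφ_iterate_sY_eq_rotCoeff {s l m : ℤ} (hs : |s| ≤ l) (hm : -l ≤ m) (hm' : m ≤ l) (j : ℕ)
    {x : ℝ × ℝ} (hx : Real.sin (x.1 / 2) ≠ 0) :
    pdφ^[j] (sY s l m) x = sYPrefactor s l m j x.2 *
      (rotCoeff (l - s).toNat (l + s).toNat (l + m).toNat x.1 : ℂ) := by
  obtain ⟨hs1, hs2⟩ := abs_le.1 hs
  rw [pdφ_iterate_sY]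
  simp only [sY]
  rw [mul_assoc _ ((Real.sin (x.1 / 2) : ℂ) ^ (2 * l)), wigner_sum_eq hs hm hx]
  have e : (l - s).toNat + (l + s).toNat - (l + m).toNat = (l - m).toNat := by omega
  have hl : (0 : ℝ) ≤ l := by exact_mod_cast (abs_nonneg s).trans hs
  have halm : alm l m = √((2 * (l : ℝ) + 1) / (4 * Real.pi)) *
      √(((l + m).toNat.factorial : ℝ) * ((l - m).toNat.factorial : ℝ)) := by
    rw [alm, ← Real.sqrt_mul (by positivity)]
    congr 1
    ring
  rw [halm, rotCoeff, e, sYPrefactor]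
  push_cast
  ring

theorem norm_sYPrefactor_mul_le {s l m : ℤ} (hs : |s| ≤ l) (hm : -l ≤ m) (hm' : m ≤ l) (j : ℕ)
    (φ : ℝ) :
    ‖sYPrefactor s l m j φ‖ *
      √(((l - s).toNat.factorial : ℝ) * ((l + s).toNat.factorial : ℝ)) ≤
    ((l : ℝ) + 1) ^ j * (2 * ((l : ℝ) + 1)) := by
  have hl : (0 : ℝ) ≤ l := by exact_mod_cast (abs_nonneg s).trans hs
  have hexp : ‖Complex.exp (Complex.I * (m : ℂ) * (φ : ℂ))‖ = 1 := by
    rw [show Complex.I * (m : ℂ) * (φ : ℂ) = ((m * φ : ℝ) : ℂ) * Complex.I by push_cast; ring]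
    exact Complex.norm_exp_ofReal_mul_I _
  have hpos : (0 : ℝ) < √(((l + s).toNat.factorial : ℝ) * ((l - s).toNat.factorial : ℝ)) := by
    positivity
  have hmabs : |(m : ℝ)| ≤ (l : ℝ) + 1 := by
    rw [abs_le]
    have h1 : (-l : ℝ) ≤ m := by exact_mod_cast hm
    have h2 : (m : ℝ) ≤ l := by exact_mod_cast hm'
    constructor <;> linarith
  have hsqrt : √((2 * (l : ℝ) + 1) / (4 * Real.pi)) ≤ 2 * ((l : ℝ) + 1) := by
    rw [Real.sqrt_le_iff]
    refine ⟨by positivity, ?_⟩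
    have : (2 * (l : ℝ) + 1) / (4 * Real.pi) ≤ 2 * (l : ℝ) + 1 :=
      div_le_self (by positivity) (by linarith [Real.pi_gt_three])
    nlinarith
  rw [sYPrefactor, norm_mul, norm_mul, norm_mul, norm_pow, norm_mul, hexp, norm_zpow,
    Complex.norm_I, norm_neg, norm_one, one_zpow, Complex.norm_real, Complex.norm_intCast,
    one_mul, mul_one, mul_one, Real.norm_of_nonneg (by positivity),
    mul_comm ((l - s).toNat.factorial : ℝ), mul_assoc, div_mul_cancel₀ _ hpos.ne']
  gcongr

/-- **Polynomial growth of derivatives of spin spherical harmonics on compacta** (Statement 5). -/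
theorem sY_deriv_poly_growth (s : ℤ) (F : Set (ℝ × ℝ)) (hFc : IsCompact F)
    (hFsub : F ⊆ Set.Ioo 0 Real.pi ×ˢ Set.univ) (i j : ℕ) :
    ∃ C : ℝ, 0 < C ∧ ∃ M : ℕ, ∀ l m : ℤ, |s| ≤ l → -l ≤ m → m ≤ l →
      ∀ x ∈ F, ‖(pdθ^[i] (pdφ^[j] (sY s l m))) x‖ ≤ C * ((l : ℝ) + 1) ^ M := by
  refine ⟨2 ^ (i + 1), by positivity, i + j + 1, fun l m hs hm hm' x hx => ?_⟩
  obtain ⟨hs1, hs2⟩ := abs_le.1 hs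
  have hl : (0 : ℝ) ≤ l := by exact_mod_cast (abs_nonneg s).trans hs
  set a := (l - s).toNat with ha
  set b := (l + s).toNat with hb
  have hab : ((a + b : ℕ) : ℝ) = 2 * l := by
    have : ((a + b : ℕ) : ℤ) = 2 * l := by omega
    exact_mod_cast this
  let f : ℕ → ℝ → ℂ := fun k t => sYPrefactor s l m j x.2 * (rotCoeff a b k t : ℂ)
  have hU : (fun t => pdφ^[j] (sY s l m) (t, x.2)) =ᶠ[nhds x.1] f (l + m).toNat := by
    filter_upwards [isOpen_Ioo.mem_nhds (hFsub hx).1] with t ht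
    refine pdφ_iterate_sY_eq_rotCoeff hs hm hm' j (x := (t, x.2)) ?_
    exact (Real.sin_pos_of_pos_of_lt_pi (by linarith [ht.1]) (by linarith [ht.1, ht.2])).ne'
  rw [pdθ_iterate, hU.iteratedDeriv_eq]
  refine (norm_iteratedDeriv_le_of_ladder (abs_ladder_le (a + b))
    (fun k => abs_ladder_le (a + b) (k + 1)) i f
    (((l : ℝ) + 1) ^ j * (2 * ((l : ℝ) + 1))) (fun k t => ?_) (fun k t => ?_) _ _).trans ?_
  · refine ((hasDerivAt_rotCoeff a b k t).ofReal_comp.const_mul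
      (sYPrefactor s l m j x.2)).congr_deriv ?_
    simp only [f]
    push_cast
    ring
  · rw [norm_mul, Complex.norm_real, Real.norm_eq_abs]
    exact (mul_le_mul_of_nonneg_left (abs_rotCoeff_le a b k t) (norm_nonneg _)).trans
      (norm_sYPrefactor_mul_le hs hm hm' j x.2)
  · rw [hab]
    calc (2 * ((2 * (l : ℝ) + 1) / 2)) ^ i * (((l : ℝ) + 1) ^ j * (2 * ((l : ℝ) + 1)))
        ≤ (2 * ((l : ℝ) + 1)) ^ i * (((l : ℝ) + 1) ^ j * (2 * ((l : ℝ) + 1))) := by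
          gcongr
          linarith
      _ = 2 ^ (i + 1) * ((l : ℝ) + 1) ^ (i + j + 1) := by
          rw [mul_pow]
          ring
end
end
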